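/- (Springer) Assume τ is a regular element, i.e. V_reg^τ ≠ ∅. Then the map sending the W^τ-orbit of a point v ∈ V^τ to its W-orbit is a bijection from the set of W^τ-orbits on V^τ onto the set of τ-stable W-orbits on V. -/

import Mathlib

open Module

noncomputable section

variable {V : Type*} [AddCommGroup V] [Module ℂ V] [FiniteDimensional ℂ V]

/-- `g` is a reflection: its fixed-point subspace has codimension 1. -/
def IsReflection (g : V ≃ₗ[ℂ] V) : Prop :=
  finrank ℂ (LinearMap.ker ((g : V →ₗ[ℂ] V) - LinearMap.id)) + 1 = finrank ℂ V

/-- The set of points of `V` with trivial stabilizer in `W`. -/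
def VReg (W : Subgroup (V ≃ₗ[ℂ] V)) : Set V :=
  {v | ∀ w ∈ W, w v = v → w = 1}

/-! ### Polynomial functions on `V` and the action of `GL(V)` on them -/

/-- Polynomials in the coordinates of a chosen basis of `V`. -/
abbrev PolyFun (V : Type*) [AddCommGroup V] [Module ℂ V] [FiniteDimensional ℂ V] : Type :=
  MvPolynomial (Fin (finrank ℂ V)) ℂ

namespace PolyFun

open MvPolynomial

/-- The value of a polynomial at a point of `V`. -/
def ev (v : V) : PolyFun V →ₐ[ℂ] ℂ := aeval fun i => (finBasis ℂ V).repr v i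

/-- A linear form on `V` as a polynomial. -/
def ofDual (ℓ : V →ₗ[ℂ] ℂ) : PolyFun V := ∑ j, C (ℓ (finBasis ℂ V j)) * X j

lemma ev_ofDual (ℓ : V →ₗ[ℂ] ℂ) (v : V) : ev v (ofDual ℓ) = ℓ v := by
  have h : ℓ v = ∑ i, (finBasis ℂ V).repr v i * ℓ (finBasis ℂ V i) := by
    conv_lhs => rw [← (finBasis ℂ V).sum_repr v]
    simp only [map_sum, map_smul, smul_eq_mul]
  simp [h, ev, ofDual, mul_comm]

@[simp]
lemma ev_C (c : ℂ) (v : V) : ev v (C c) = c := (ev v).commutes c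

lemma ext_ev {f g : PolyFun V} (h : ∀ v : V, ev v f = ev v g) : f = g := by
  apply MvPolynomial.funext
  intro x
  have := h ((finBasis ℂ V).equivFun.symm x)
  have hx : (fun i => (finBasis ℂ V).repr ((finBasis ℂ V).equivFun.symm x) i) = x :=
    (finBasis ℂ V).equivFun.apply_symm_apply x
  change aeval _ f = aeval _ g at this
  rw [hx] at this
  exact this

lemma totalDegree_ofDual_le (ℓ : V →ₗ[ℂ] ℂ) : (ofDual ℓ).totalDegree ≤ 1 := by
  refine totalDegree_finsetSum_le fun j _ => (totalDegree_mul _ _).trans ?_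
  simp

lemma totalDegree_ofDual {ℓ : V →ₗ[ℂ] ℂ} (h : ℓ ≠ 0) : (ofDual ℓ).totalDegree = 1 := by
  refine le_antisymm (totalDegree_ofDual_le ℓ) (Nat.one_le_iff_ne_zero.2 fun h0 => h ?_)
  rw [totalDegree_eq_zero_iff_eq_C] at h0
  have hc (v : V) : ℓ v = coeff 0 (ofDual ℓ) := by
    rw [← ev_ofDual, h0]; simp [ev]
  ext v
  rw [hc v, ← hc 0]; simp

/-- Precomposition with `g⁻¹` on polynomials. -/
def act (g : V ≃ₗ[ℂ] V) : PolyFun V →ₐ[ℂ] PolyFun V :=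
  aeval fun i => ofDual ((finBasis ℂ V).coord i ∘ₗ (g⁻¹ : V ≃ₗ[ℂ] V).toLinearMap)

lemma ev_act (g : V ≃ₗ[ℂ] V) (f : PolyFun V) (v : V) : ev v (act g f) = ev (g⁻¹ v) f := by
  have : (ev v).comp (act g) = ev (g⁻¹ v) := by
    apply MvPolynomial.algHom_ext
    intro i
    simp only [AlgHom.comp_apply, act, aeval_X, ev_ofDual]
    simp [ev]
  exact DFunLike.congr_fun this f

instance : MulSemiringAction (V ≃ₗ[ℂ] V) (PolyFun V) where
  smul g f := act g f
  one_smul f := ext_ev fun v => (ev_act _ _ _).trans (by simp)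
  mul_smul g h f := ext_ev fun v => by
    change ev v (act (g * h) f) = ev v (act g (act h f))
    simp only [ev_act, mul_inv_rev, LinearEquiv.mul_apply]
  smul_zero g := map_zero (act g)
  smul_add g := map_add (act g)
  smul_one g := map_one (act g)
  smul_mul g := map_mul (act g)

@[simp]
lemma ev_smul (g : V ≃ₗ[ℂ] V) (f : PolyFun V) (v : V) : ev v (g • f) = ev (g⁻¹ v) f :=
  ev_act g f v

instance : SMulCommClass (V ≃ₗ[ℂ] V) ℂ (PolyFun V) where
  smul_comm g c f := map_smul (act g) c f

lemma totalDegree_smul_le (g : V ≃ₗ[ℂ] V) (f : PolyFun V) :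
    (g • f).totalDegree ≤ f.totalDegree := by
  change (act g f).totalDegree ≤ _
  rw [act, aeval_def, eval₂_eq']
  refine totalDegree_finsetSum_le fun d hd => (totalDegree_mul _ _).trans ?_
  rw [algebraMap_eq, totalDegree_C, zero_add]
  refine (totalDegree_finsetProd _ _).trans ((Finset.sum_le_sum fun i _ =>
    (totalDegree_pow _ _).trans (Nat.mul_le_mul_left _ (totalDegree_ofDual_le _))).trans ?_)
  refine le_trans (le_of_eq ?_) (le_totalDegree hd)
  simp [Finsupp.sum_fintype]

/-- For every point outside a finite set there is a polynomial with value `1` there and vanishing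
on the finite set. -/
lemma exists_ev_eq_one (v : V) (T : Finset V) (hv : v ∉ T) :
    ∃ f : PolyFun V, ev v f = 1 ∧ ∀ u ∈ T, ev u f = 0 := by
  have key (u : V) (hu : u ≠ v) : ∃ f : PolyFun V, ev v f = 1 ∧ ev u f = 0 := by
    obtain ⟨ℓ, hℓ⟩ := Projective.exists_dual_eq_one ℂ (sub_ne_zero.2 hu.symm)
    refine ⟨ofDual ℓ - C (ℓ u), ?_, ?_⟩
    · rw [map_sub, ev_ofDual, ← hℓ, map_sub]; simp [ev]
    · rw [map_sub, ev_ofDual]; simp [ev]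
  choose! f hf using key
  refine ⟨∏ u ∈ T, f u, ?_, fun u hu => ?_⟩
  · rw [map_prod]
    exact Finset.prod_eq_one fun u hu => (hf u (ne_of_mem_of_not_mem hu hv)).1
  · rw [map_prod]
    exact Finset.prod_eq_zero hu (hf u (ne_of_mem_of_not_mem hu hv)).2

/-- A polynomial vanishing at all but finitely many points of a line vanishes on the line. -/
lemma ev_line_eq_zero (f : PolyFun V) (u v : V) (T : Set ℂ) (hT : T.Finite)
    (h : ∀ t ∉ T, ev (u + t • v) f = 0) (t : ℂ) : ev (u + t • v) f = 0 := by
  let q : Polynomial ℂ := aeval (fun i => Polynomial.C ((finBasis ℂ V).repr u i) +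
    Polynomial.X * Polynomial.C ((finBasis ℂ V).repr v i)) f
  have hq (s : ℂ) : q.eval s = ev (u + s • v) f := by
    have : (Polynomial.aeval s).comp (aeval (fun i => Polynomial.C ((finBasis ℂ V).repr u i) +
        Polynomial.X * Polynomial.C ((finBasis ℂ V).repr v i))) = ev (u + s • v) := by
      apply MvPolynomial.algHom_ext
      intro i
      simp only [AlgHom.comp_apply, aeval_X, ev, map_add, map_mul, Polynomial.aeval_X,
        Polynomial.aeval_C, map_smul, Finsupp.add_apply, Finsupp.smul_apply, smul_eq_mul,
        Algebra.algebraMap_self, RingHom.id_apply]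
    have := DFunLike.congr_fun this f
    simpa [q, Polynomial.coe_aeval_eq_eval] using this
  have hq0 : q = 0 := by
    refine Polynomial.eq_zero_of_infinite_isRoot q (hT.infinite_compl.mono fun s hs => ?_)
    exact (hq s).trans (h s hs)
  rw [← hq, hq0, Polynomial.eval_zero]

/-! ### Invariants of a complex reflection group -/

/-- The algebra of `W`-invariant polynomials. -/
abbrev invariants (W : Subgroup (V ≃ₗ[ℂ] V)) : Subalgebra ℂ (PolyFun V) :=
  FixedPoints.subalgebra ℂ (PolyFun V) W

lemma mem_invariants {W : Subgroup (V ≃ₗ[ℂ] V)} {f : PolyFun V} :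
    f ∈ invariants W ↔ ∀ g ∈ W, g • f = f :=
  ⟨fun h g hg => h ⟨g, hg⟩, fun h g => h g g.2⟩

lemma ev_invariant {W : Subgroup (V ≃ₗ[ℂ] V)} {f : PolyFun V} (hf : f ∈ invariants W)
    {g : V ≃ₗ[ℂ] V} (hg : g ∈ W) (v : V) : ev (g v) f = ev v f := by
  conv_rhs => rw [← mem_invariants.1 hf _ (W.inv_mem hg), ev_smul, inv_inv]

lemma sum_smul_mem_invariants (W : Subgroup (V ≃ₗ[ℂ] V)) [Fintype W] (f : PolyFun V) :
    ∑ w : W, (w : V ≃ₗ[ℂ] V) • f ∈ invariants W := by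
  rw [mem_invariants]
  intro g hg
  rw [Finset.smul_sum]
  exact Fintype.sum_equiv (Equiv.mulLeft ⟨g, hg⟩) _ _ fun w => by simp [mul_smul]

/-- A reflection changes a polynomial by a multiple of a fixed nonzero linear form. -/
lemma exists_smul_sub_eq_mul {g : V ≃ₗ[ℂ] V} (hg : IsReflection g) :
    ∃ ℓ : V →ₗ[ℂ] ℂ, ℓ ≠ 0 ∧ ∀ f : PolyFun V, ofDual ℓ ∣ g • f - f := by
  have hrank : finrank ℂ (LinearMap.range ((g : V →ₗ[ℂ] V) - LinearMap.id)) = 1 := by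
    have := LinearMap.finrank_range_add_finrank_ker ((g : V →ₗ[ℂ] V) - LinearMap.id)
    unfold IsReflection at hg
    omega
  obtain ⟨⟨a, y, hy⟩, ha0, ha⟩ := finrank_eq_one_iff'.1 hrank
  obtain ⟨l, hl⟩ := Projective.exists_dual_eq_one ℂ (x := a) (fun h => ha0 (Subtype.ext h))
  have hga (x : V) : g x - x = l (g x - x) • a := by
    obtain ⟨c, hc⟩ := ha ⟨g x - x, x, rfl⟩
    have hc' : c • a = g x - x := congrArg Subtype.val hc
    rw [← hc', map_smul, hl, smul_eq_mul, mul_one]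
  refine ⟨l ∘ₗ ((g⁻¹ : V ≃ₗ[ℂ] V).toLinearMap - LinearMap.id), ?_, fun f => ?_⟩
  · intro h
    have h1 := LinearMap.congr_fun h (g y)
    have h2 : l (g y - y) = 1 := by rw [← hl, ← hy]; rfl
    have h3 : (g⁻¹ : V ≃ₗ[ℂ] V) (g y) = y := g.symm_apply_apply y
    simp only [LinearMap.comp_apply, LinearMap.sub_apply, LinearMap.id_apply,
      LinearEquiv.coe_coe, h3, LinearMap.zero_apply] at h1
    rw [← neg_sub, map_neg, h1, neg_zero] at h2
    exact zero_ne_one h2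
  · have hinv (x : V) : (g⁻¹ : V ≃ₗ[ℂ] V) x - x = l ((g⁻¹ : V ≃ₗ[ℂ] V) x - x) • a := by
      have h3 : g ((g⁻¹ : V ≃ₗ[ℂ] V) x) = x := g.apply_symm_apply x
      have := hga ((g⁻¹ : V ≃ₗ[ℂ] V) x)
      rw [h3] at this
      rw [← neg_sub x, map_neg, neg_smul, ← this]
    induction f using MvPolynomial.induction_on with
    | C c =>
      have : g • (C c : PolyFun V) = C c := ext_ev fun v => by rw [ev_smul, ev_C, ev_C]
      simp [this]
    | add p q hp hq =>
      rw [smul_add, add_sub_add_comm]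
      exact dvd_add hp hq
    | mul_X p i hp =>
      have hX : g • (X i : PolyFun V) - X i =
          ofDual (l ∘ₗ ((g⁻¹ : V ≃ₗ[ℂ] V).toLinearMap - LinearMap.id)) *
            C ((finBasis ℂ V).repr a i) := ext_ev fun v => by
        have := congrArg (fun x => (finBasis ℂ V).repr x i) (hinv v)
        simp only [map_sub, map_mul, ev_smul, ev_ofDual]
        simpa [ev] using this
      have : g • (p * X i) - p * X i = (g • p - p) * (g • (X i : PolyFun V)) +
          p * (g • (X i : PolyFun V) - X i) := by
        rw [smul_mul']; ring
      rw [this]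
      exact dvd_add (hp.mul_right _) ((Dvd.intro _ hX.symm).mul_left _)

/-- A system of linear relations over the invariants with coefficients in all polynomials is
spanned by its invariant solutions. -/
lemma mem_span_relations (W : Subgroup (V ≃ₗ[ℂ] V)) [Finite W]
    (hW : Subgroup.closure {g : V ≃ₗ[ℂ] V | g ∈ W ∧ IsReflection g} = W) {l : ℕ}
    (r : Fin l → PolyFun V) (hr : ∀ i, r i ∈ invariants W) (d : ℕ) (s : Fin l → PolyFun V)
    (hd : ∀ i, s i = 0 ∨ (s i).totalDegree < d) (hs : ∑ i, r i * s i = 0) :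
    s ∈ Submodule.span (PolyFun V)
      {a : Fin l → PolyFun V | (∀ i, a i ∈ invariants W) ∧ ∑ i, r i * a i = 0} := by
  induction d generalizing s with
  | zero =>
    convert Submodule.zero_mem _
    ext1 i
    simpa using hd i
  | succ d ih =>
    set K := Submodule.span (PolyFun V)
      {a : Fin l → PolyFun V | (∀ i, a i ∈ invariants W) ∧ ∑ i, r i * a i = 0}
    have hdeg (g : V ≃ₗ[ℂ] V) {f : PolyFun V} (hf : f = 0 ∨ f.totalDegree < d + 1) :
        g • f = 0 ∨ (g • f).totalDegree < d + 1 :=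
      hf.imp (fun h => by rw [h, smul_zero]) (totalDegree_smul_le g f).trans_lt
    have hrel {g : V ≃ₗ[ℂ] V} (hg : g ∈ W) {s : Fin l → PolyFun V}
        (hs : ∑ i, r i * s i = 0) : ∑ i, r i * g • s i = 0 := by
      rw [← smul_zero g, ← hs, Finset.smul_sum]
      exact Finset.sum_congr rfl fun i _ => by rw [smul_mul', mem_invariants.1 (hr i) g hg]
    have hsub : ∀ g ∈ W, ∀ s : Fin l → PolyFun V, (∀ i, s i = 0 ∨ (s i).totalDegree < d + 1) →
        ∑ i, r i * s i = 0 → g • s - s ∈ K := by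
      intro g hg
      rw [← hW] at hg
      induction hg using Subgroup.closure_induction with
      | mem g hg =>
        intro s hd hs
        obtain ⟨ℓ, hℓ, hdvd⟩ := exists_smul_sub_eq_mul hg.2
        have hℓ1 := totalDegree_ofDual hℓ
        have hℓ0 : ofDual ℓ ≠ 0 := by
          intro h
          rw [h, totalDegree_zero] at hℓ1
          exact zero_ne_one hℓ1
        choose t ht using fun i => hdvd (s i)
        have : g • s - s = ofDual ℓ • t := funext fun i => ht i
        rw [this]
        refine K.smul_mem _ (ih t (fun i => ?_) ?_)
        · by_cases h0 : t i = 0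
          · exact Or.inl h0
          right
          have h1 := totalDegree_mul_of_isDomain hℓ0 h0
          rw [← ht i, hℓ1] at h1
          have h2 := totalDegree_sub (g • s i) (s i)
          have h3 := totalDegree_smul_le g (s i)
          rcases hd i with h | h
          · exact absurd (ht i) (by simpa [h] using (mul_ne_zero hℓ0 h0).symm)
          · have := max_le h3 le_rfl
            omega
        · refine (mul_eq_zero.1 ?_).resolve_left hℓ0
          rw [Finset.mul_sum]
          calc ∑ i, ofDual ℓ * (r i * t i) = ∑ i, (r i * g • s i - r i * s i) :=
                Finset.sum_congr rfl fun i _ => by rw [← mul_sub, ht i]; ring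
            _ = 0 := by rw [Finset.sum_sub_distrib, hrel hg.1 hs, hs, sub_zero]
      | one => intro s _ _; simp
      | mul g h hg hh ihg ihh =>
        intro s hd hs
        rw [hW] at hh
        have h1 := ihg (h • s) (fun i => hdeg h (hd i)) (hrel hh hs)
        have h2 := ihh s hd hs
        rw [mul_smul]
        simpa using K.add_mem h1 h2
      | inv g hg ihg =>
        intro s hd hs
        rw [hW] at hg
        have h1 := ihg (g⁻¹ • s) (fun i => hdeg g⁻¹ (hd i)) (hrel (W.inv_mem hg) hs)
        simpa using K.neg_mem h1
    have := Fintype.ofFinite W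
    have havg : ∑ w : W, ((w : V ≃ₗ[ℂ] V) • s) ∈ K := by
      refine Submodule.subset_span ⟨fun i => ?_, ?_⟩
      · rw [Finset.sum_apply]
        exact sum_smul_mem_invariants W (s i)
      · simp only [Finset.sum_apply, Finset.mul_sum]
        rw [Finset.sum_comm]
        exact Finset.sum_eq_zero fun w _ => hrel w.2 hs
    have hdiff : ∑ w : W, ((w : V ≃ₗ[ℂ] V) • s - s) ∈ K :=
      K.sum_mem fun w _ => hsub w w.2 s hd hs
    rw [Finset.sum_sub_distrib, Finset.sum_const, Finset.card_univ] at hdiff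
    have hcard := (Submodule.sub_mem_iff_right _ havg).1 hdiff
    have hs' : s = (C ((Fintype.card W : ℂ)⁻¹) : PolyFun V) • (Fintype.card W • s) := by
      ext1 i
      rw [Pi.smul_apply, Pi.smul_apply, nsmul_eq_mul, smul_eq_mul, ← mul_assoc,
        ← map_natCast (C (σ := Fin (finrank ℂ V)) (R := ℂ)), ← map_mul,
        inv_mul_cancel₀ (by simp), map_one, one_mul]
    rw [hs']
    exact K.smul_mem _ hcard

lemma flat_invariants (W : Subgroup (V ≃ₗ[ℂ] V)) [Finite W]
    (hW : Subgroup.closure {g : V ≃ₗ[ℂ] V | g ∈ W ∧ IsReflection g} = W) :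
    Module.Flat (invariants W) (PolyFun V) := by
  refine Module.Flat.of_forall_isTrivialRelation fun {l r s} hs => ?_
  have hmem := mem_span_relations W hW (fun i => (r i : PolyFun V)) (fun i => (r i).2)
    (∑ i, (s i).totalDegree + 1) s
    (fun i => Or.inr (Nat.lt_succ_of_le (Finset.single_le_sum
      (f := fun i => (s i).totalDegree) (fun _ _ => Nat.zero_le _) (Finset.mem_univ i)))) hs
  obtain ⟨k, y, a, ha⟩ := Submodule.mem_span_set'.1 hmem
  refine ⟨k, fun i j => ⟨(a j).1 i, (a j).2.1 i⟩, y, fun i => ?_, fun j => ?_⟩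
  · rw [← ha, Finset.sum_apply]
    exact Finset.sum_congr rfl fun j _ => mul_comm _ _
  · apply Subtype.ext
    simpa using (a j).2.2

/-- Finitely many polynomials `h i` and functionals `φ i` that are linear over the invariants and
satisfy `s = ∑ i, φ i s * h i`. -/
structure IsDualSystem (W : Subgroup (V ≃ₗ[ℂ] V)) {n : ℕ} (h : Fin n → PolyFun V)
    (φ : Fin n → PolyFun V →+ PolyFun V) : Prop where
  mem : ∀ i s, φ i s ∈ invariants W
  map_mul : ∀ i, ∀ r ∈ invariants W, ∀ s, φ i (r * s) = r * φ i s
  sum_eq : ∀ s, ∑ i, φ i s * h i = s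

lemma exists_isDualSystem (W : Subgroup (V ≃ₗ[ℂ] V)) [Finite W]
    (hW : Subgroup.closure {g : V ≃ₗ[ℂ] V | g ∈ W ∧ IsReflection g} = W) :
    ∃ (n : ℕ) (h : Fin n → PolyFun V) (φ : Fin n → PolyFun V →+ PolyFun V),
      IsDualSystem W h φ := by
  have := flat_invariants W hW
  have : Algebra.IsInvariant (invariants W) (PolyFun V) W := ⟨fun f hf => ⟨⟨f, hf⟩, rfl⟩⟩
  have : Algebra.IsIntegral (invariants W) (PolyFun V) := Algebra.IsInvariant.isIntegral _ _ W
  have : Algebra.FiniteType (invariants W) (PolyFun V) :=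
    Algebra.FiniteType.of_restrictScalars_finiteType ℂ _ _
  have hfin : Module.Finite (invariants W) (PolyFun V) := Algebra.IsIntegral.finite
  have hfg : (⊤ : Subalgebra ℂ (invariants W)).FG :=
    fg_of_fg_of_fg ℂ (invariants W) (PolyFun V) Algebra.FiniteType.out hfin.fg_top
      Subtype.val_injective
  have : Algebra.FiniteType ℂ (invariants W) := ⟨hfg⟩
  have : IsNoetherianRing (invariants W) := Algebra.FiniteType.isNoetherianRing ℂ _
  have := Module.finitePresentation_of_finite (invariants W) (PolyFun V)
  have : Module.Projective (invariants W) (PolyFun V) :=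
    Module.Flat.projective_of_finitePresentation
  obtain ⟨n, f, g, -, -, hfg⟩ :=
    Module.Finite.exists_comp_eq_id_of_projective (invariants W) (PolyFun V)
  refine ⟨n, fun i => f fun j => if i = j then 1 else 0, fun i => ((invariants W).val.toLinearMap.toAddMonoidHom.comp
    ((LinearMap.proj i).comp g).toAddMonoidHom), fun i s => (g s i).2, fun i r hr s => ?_,
    fun s => ?_⟩
  · have : r * s = (⟨r, hr⟩ : invariants W) • s := rfl
    rw [this]
    simp
  · conv_rhs => rw [← LinearMap.id_apply (R := invariants W) s, ← hfg, LinearMap.comp_apply,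
      LinearMap.pi_apply_eq_sum_univ f (g s)]
    rfl

/-! ### The twisted trace -/

/-- Multiplication by `f` followed by `τ`. -/
def twist (τ : V ≃ₗ[ℂ] V) (f : PolyFun V) : PolyFun V →+ PolyFun V :=
  (DistribSMul.toAddMonoidHom _ τ).comp (AddMonoidHom.mulLeft f)

lemma twist_apply (τ : V ≃ₗ[ℂ] V) (f s : PolyFun V) : twist τ f s = τ • (f * s) := rfl

lemma smul_mem_invariants {W : Subgroup (V ≃ₗ[ℂ] V)} {τ : V ≃ₗ[ℂ] V}
    (hτ : ∀ g ∈ W, τ⁻¹ * g * τ ∈ W) {r : PolyFun V} (hr : r ∈ invariants W) :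
    τ • r ∈ invariants W := by
  rw [mem_invariants] at hr ⊢
  intro g hg
  calc g • τ • r = τ • (τ⁻¹ * g * τ) • r := by simp only [← mul_smul]; group
    _ = τ • r := by rw [hr _ (hτ g hg)]

/-- The trace of a `τ`-semilinear map and its cyclicity, evaluated at a point whose orbit is
`τ`-stable. -/
lemma sum_ev_dual_comm {W : Subgroup (V ≃ₗ[ℂ] V)} {τ : V ≃ₗ[ℂ] V}
    (hτ : ∀ g ∈ W, τ⁻¹ * g * τ ∈ W) {v : V}
    (hv : ∀ r ∈ invariants W, ev v (τ • r) = ev v r) {m n : ℕ} {h : Fin m → PolyFun V}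
    {φ : Fin m → PolyFun V →+ PolyFun V} {k : Fin n → PolyFun V}
    {ψ : Fin n → PolyFun V →+ PolyFun V} (hφ : IsDualSystem W h φ) (hψ : IsDualSystem W k ψ)
    (T U : PolyFun V →+ PolyFun V) (hT : ∀ r ∈ invariants W, ∀ s, T (r * s) = τ • r * T s)
    (hU : ∀ r ∈ invariants W, ∀ s, U (r * s) = r * U s) :
    ∑ i, ev v (φ i (U (T (h i)))) = ∑ j, ev v (ψ j (T (U (k j)))) := by
  have hL (i : Fin m) : ev v (φ i (U (T (h i)))) =
      ∑ j, ev v (φ i (U (k j))) * ev v (ψ j (T (h i))) := by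
    conv_lhs => rw [← hψ.sum_eq (T (h i))]
    simp only [map_sum]
    refine Finset.sum_congr rfl fun j _ => ?_
    rw [hU _ (hψ.mem _ _), hφ.map_mul _ _ (hψ.mem _ _), map_mul, mul_comm]
  have hR (j : Fin n) : ev v (ψ j (T (U (k j)))) =
      ∑ i, ev v (φ i (U (k j))) * ev v (ψ j (T (h i))) := by
    conv_lhs => rw [← hφ.sum_eq (U (k j))]
    simp only [map_sum]
    refine Finset.sum_congr rfl fun i _ => ?_
    rw [hT _ (hφ.mem _ _), hψ.map_mul _ _ (smul_mem_invariants hτ (hφ.mem _ _)), map_mul,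
      hv _ (hφ.mem _ _)]
  simp only [hL, hR]
  exact Finset.sum_comm

lemma exists_ev_orbit {W : Subgroup (V ≃ₗ[ℂ] V)} [Finite W] {v : V} (hv : v ∈ VReg W)
    (w : W) : ∃ e : PolyFun V, ev ((w : V ≃ₗ[ℂ] V) v) e = 1 ∧
      ∀ x : W, x ≠ w → ev ((x : V ≃ₗ[ℂ] V) v) e = 0 := by
  classical
  have := Fintype.ofFinite W
  obtain ⟨e, he, he'⟩ := exists_ev_eq_one ((w : V ≃ₗ[ℂ] V) v)
    ((Finset.univ.erase w).image fun x : W => (x : V ≃ₗ[ℂ] V) v) (by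
      simp only [Finset.mem_image, Finset.mem_erase, Finset.mem_univ, and_true, not_exists, not_and]
      intro x hxw hx
      refine hxw (inv_mul_eq_one.1 (Subtype.ext (hv _ (w⁻¹ * x).2 ?_))).symm
      rw [Subgroup.coe_mul, LinearEquiv.mul_apply, hx, Subgroup.coe_inv]
      exact LinearEquiv.symm_apply_apply _ _)
  exact ⟨e, he, fun x hx => he' _ (Finset.mem_image_of_mem _ (by simpa using hx))⟩

lemma ev_map_sum_prod_eq_zero {W : Subgroup (V ≃ₗ[ℂ] V)} [Fintype W] {v : V}
    (φ : PolyFun V →+ PolyFun V) (hφ : ∀ r ∈ invariants W, ∀ s, φ (r * s) = r * φ s)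
    {s : PolyFun V} (hs : ∀ w ∈ W, ev (w v) s = 0) (e : PolyFun V) (T : Finset W)
    (a b : PolyFun V) :
    ev v (φ (∑ x : W, b * (x : V ≃ₗ[ℂ] V) • a *
      (∏ w ∈ T, ((x : V ≃ₗ[ℂ] V) • e - (w : V ≃ₗ[ℂ] V) • e)) * (x : V ≃ₗ[ℂ] V) • s)) = 0 := by
  classical
  induction T using Finset.induction_on generalizing a b with
  | empty =>
    have : ∑ x : W, b * (x : V ≃ₗ[ℂ] V) • a *
        (∏ w ∈ (∅ : Finset W), ((x : V ≃ₗ[ℂ] V) • e - (w : V ≃ₗ[ℂ] V) • e)) *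
          (x : V ≃ₗ[ℂ] V) • s = (∑ x : W, (x : V ≃ₗ[ℂ] V) • (a * s)) * b := by
      rw [Finset.sum_mul]
      refine Finset.sum_congr rfl fun x _ => ?_
      rw [Finset.prod_empty, smul_mul']
      ring
    rw [this, hφ _ (sum_smul_mem_invariants W _), map_mul, map_sum, Finset.sum_eq_zero, zero_mul]
    intro x _
    rw [ev_smul, map_mul, hs _ (W.inv_mem x.2), mul_zero]
  | insert w T hw ih =>
    have h1 := ih (a * e) b
    have h2 := ih a (b * (w : V ≃ₗ[ℂ] V) • e)
    rw [← sub_eq_zero.2 (h1.trans h2.symm), ← map_sub, ← map_sub, ← Finset.sum_sub_distrib]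
    congr 2
    refine Finset.sum_congr rfl fun x _ => ?_
    rw [Finset.prod_insert hw, smul_mul']
    ring

lemma ev_map_mul_prod_eq_zero {W : Subgroup (V ≃ₗ[ℂ] V)} [Fintype W] [DecidableEq W] {v : V}
    (φ : PolyFun V →+ PolyFun V) (hφ : ∀ r ∈ invariants W, ∀ s, φ (r * s) = r * φ s)
    {s : PolyFun V} (hs : ∀ w ∈ W, ev (w v) s = 0) (e b : PolyFun V) :
    ev v (φ (b * (∏ w ∈ Finset.univ.erase (1 : W), (e - (w : V ≃ₗ[ℂ] V) • e)) * s)) = 0 := by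
  rw [← ev_map_sum_prod_eq_zero φ hφ hs e (Finset.univ.erase 1) 1 b]
  congr 2
  rw [Finset.sum_eq_single 1]
  · rw [Subgroup.coe_one, smul_one, mul_one, one_smul, one_smul]
  · intro x _ hx
    rw [Finset.prod_eq_zero (i := x) (by simpa using hx) (sub_self _), mul_zero, zero_mul]
  · simp

/-- Functionals linear over the invariants, evaluated at a regular point, only depend on the
values of a polynomial on the orbit of this point. -/
lemma ev_map_eq_zero {W : Subgroup (V ≃ₗ[ℂ] V)} [Finite W] {v : V} (hv : v ∈ VReg W)
    (φ : PolyFun V →+ PolyFun V) (hφ : ∀ r ∈ invariants W, ∀ s, φ (r * s) = r * φ s)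
    {s : PolyFun V} (hs : ∀ w ∈ W, ev (w v) s = 0) : ev v (φ s) = 0 := by
  classical
  have := Fintype.ofFinite W
  obtain ⟨e, he, he'⟩ := exists_ev_orbit hv 1
  rw [Subgroup.coe_one, LinearEquiv.coe_one, id] at he
  set D : PolyFun V := ∏ w ∈ Finset.univ.erase (1 : W), (e - (w : V ≃ₗ[ℂ] V) • e) with hD
  have hDv : ev v D = 1 := by
    rw [hD, map_prod]
    refine Finset.prod_eq_one fun w hw => ?_
    have := he' w⁻¹ (by simpa using hw)
    rw [Subgroup.coe_inv] at this
    rw [map_sub, ev_smul, he, this, sub_zero]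
  have ht := sum_smul_mem_invariants W (e * D)
  have htv : ev v (∑ w : W, (w : V ≃ₗ[ℂ] V) • (e * D)) = 1 := by
    rw [map_sum, Finset.sum_eq_single 1]
    · simp [he, hDv]
    · intro x _ hx
      have := he' x⁻¹ (by simpa using hx)
      rw [Subgroup.coe_inv] at this
      rw [ev_smul, map_mul, this, zero_mul]
    · simp
  rw [← one_mul (ev v (φ s)), ← htv, ← map_mul, ← hφ _ ht, Finset.sum_mul, map_sum, map_sum]
  refine Finset.sum_eq_zero fun x _ => ?_
  obtain ⟨ψ, hψ⟩ : ∃ ψ : PolyFun V →+ PolyFun V, ∀ s, ψ s = φ ((x : V ≃ₗ[ℂ] V) • s) :=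
    ⟨φ.comp (DistribSMul.toAddMonoidHom _ (x : V ≃ₗ[ℂ] V)), fun _ => rfl⟩
  have hlin : ∀ r ∈ invariants W, ∀ s, ψ (r * s) = r * ψ s := fun r hr s => by
    rw [hψ, hψ, smul_mul', mem_invariants.1 hr _ x.2, hφ r hr]
  have hs' : ∀ w ∈ W, ev (w v) ((x : V ≃ₗ[ℂ] V)⁻¹ • s) = 0 := fun w hw => by
    rw [ev_smul, inv_inv, ← LinearEquiv.mul_apply]
    exact hs _ (W.mul_mem x.2 hw)
  have hx := ev_map_mul_prod_eq_zero ψ hlin hs' e e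
  rwa [← hD, hψ, smul_mul', smul_inv_smul] at hx

lemma sum_ev_twist_of_regular {W : Subgroup (V ≃ₗ[ℂ] V)} [Fintype W] {τ : V ≃ₗ[ℂ] V}
    [DecidableEq (V ≃ₗ[ℂ] V)] (hτ : ∀ g ∈ W, τ⁻¹ * g * τ ∈ W) {n : ℕ} {h : Fin n → PolyFun V}
    {φ : Fin n → PolyFun V →+ PolyFun V} (hφ : IsDualSystem W h φ) {v : V} (hv : v ∈ VReg W)
    (hτv : τ v = v) (f : PolyFun V) :
    ∑ i, ev v (φ i (τ • (f * h i))) =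
      ∑ w : W with τ * w.1 = w.1 * τ, ev ((w : V ≃ₗ[ℂ] V) v) f := by
  choose e he he' using exists_ev_orbit hv
  have hexp (i : Fin n) (s : PolyFun V) : ev v (φ i s) =
      ∑ w : W, ev ((w : V ≃ₗ[ℂ] V) v) s * ev v (φ i (e w)) := by
    have hC (c : ℂ) : (C c : PolyFun V) ∈ invariants W := (invariants W).algebraMap_mem c
    have := ev_map_eq_zero hv (φ i) (hφ.map_mul i)
      (s := s - ∑ w : W, C (ev ((w : V ≃ₗ[ℂ] V) v) s) * e w) (fun x hx => by
        rw [map_sub, map_sum, Finset.sum_eq_single ⟨x, hx⟩]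
        · rw [map_mul, ev_C, he ⟨x, hx⟩, mul_one, sub_self]
        · intro w _ hw
          rw [map_mul, he' w ⟨x, hx⟩ hw.symm, mul_zero]
        · simp)
    rw [map_sub, map_sub, sub_eq_zero] at this
    rw [this, map_sum, map_sum]
    refine Finset.sum_congr rfl fun w _ => ?_
    rw [hφ.map_mul _ _ (hC _), map_mul, ev_C]
  have hinv : (τ⁻¹ : V ≃ₗ[ℂ] V) v = v := by
    conv_lhs => rw [← hτv]
    exact τ.symm_apply_apply v
  simp only [hexp _ (τ • _)]
  rw [Finset.sum_comm, Finset.sum_filter]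
  refine Finset.sum_congr rfl fun w _ => ?_
  have hy : (τ⁻¹ : V ≃ₗ[ℂ] V) ((w : V ≃ₗ[ℂ] V) v) = (τ⁻¹ * w * τ) v := by
    simp only [LinearEquiv.mul_apply, hτv]
  have hsum : ∑ i, ev ((w : V ≃ₗ[ℂ] V) v) (τ • (f * h i)) * ev v (φ i (e w)) =
      ev ((τ⁻¹ * w * τ) v) f * ev ((τ⁻¹ * w * τ) v) (e w) := by
    conv_rhs => rw [← hφ.sum_eq (e w), map_sum, Finset.mul_sum]
    refine Finset.sum_congr rfl fun i _ => ?_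
    rw [ev_smul, hy, map_mul, map_mul, ev_invariant (hφ.mem i (e w)) (hτ w w.2)]
    ring
  rw [hsum]
  split_ifs with hw
  · rw [mul_assoc, ← hw, inv_mul_cancel_left, he, mul_one]
  · rw [he' w ⟨_, hτ w w.2⟩, mul_zero]
    intro h
    apply hw
    have h' : τ⁻¹ * w * τ = w := congrArg Subtype.val h
    calc τ * w = τ * (τ⁻¹ * w * τ) := by rw [h']
      _ = w * τ := by group

omit [FiniteDimensional ℂ V] in
lemma finite_line_not_mem_VReg {W : Subgroup (V ≃ₗ[ℂ] V)} [Finite W] {v₀ : V}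
    (hv₀ : v₀ ∈ VReg W) (v : V) : {t : ℂ | v + t • v₀ ∉ VReg W}.Finite := by
  refine (Set.finite_iUnion (ι := {w : W // w ≠ 1})
    (f := fun w => {t : ℂ | (w.1 : V ≃ₗ[ℂ] V) (v + t • v₀) = v + t • v₀})
    fun w => Set.Subsingleton.finite ?_).subset ?_
  · intro t ht s hs
    simp only [Set.mem_ofPred_eq, map_add, map_smul] at ht hs
    by_contra hts
    have h : (t - s) • ((w.1 : V ≃ₗ[ℂ] V) v₀ - v₀) = 0 := by
      rw [smul_sub, sub_smul, sub_smul]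
      linear_combination (norm := module) ht - hs
    have h1 := (smul_eq_zero.1 h).resolve_left (sub_ne_zero.2 hts)
    exact w.2 (Subtype.ext (hv₀ _ w.1.2 (sub_eq_zero.1 h1)))
  · intro t ht
    simp only [VReg, Set.mem_ofPred_eq, not_forall] at ht
    obtain ⟨w, hw, hwt, hw1⟩ := ht
    exact Set.mem_iUnion.2 ⟨⟨⟨w, hw⟩, fun h => hw1 (congrArg Subtype.val h)⟩, hwt⟩

/-- The value of the twisted trace at a `τ`-fixed point. -/
lemma sum_ev_twist {W : Subgroup (V ≃ₗ[ℂ] V)} [Fintype W] {τ : V ≃ₗ[ℂ] V}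
    [DecidableEq (V ≃ₗ[ℂ] V)] (hτ : ∀ g ∈ W, τ⁻¹ * g * τ ∈ W) {n : ℕ} {h : Fin n → PolyFun V}
    {φ : Fin n → PolyFun V →+ PolyFun V} (hφ : IsDualSystem W h φ) {v₀ : V} (hv₀ : v₀ ∈ VReg W)
    (hτv₀ : τ v₀ = v₀) {v : V} (hτv : τ v = v) (f : PolyFun V) :
    ∑ i, ev v (φ i (τ • (f * h i))) =
      ∑ w : W with τ * w.1 = w.1 * τ, ev ((w : V ≃ₗ[ℂ] V) v) f := by
  have key := ev_line_eq_zero (∑ i, φ i (τ • (f * h i)) -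
    ∑ w : W with τ * w.1 = w.1 * τ, (w : V ≃ₗ[ℂ] V)⁻¹ • f) v v₀ _
    (finite_line_not_mem_VReg hv₀ v) (fun t ht => by
      rw [Set.mem_ofPred_eq, not_not] at ht
      rw [map_sub, map_sum, map_sum, sub_eq_zero, sum_ev_twist_of_regular hτ hφ ht
        (by rw [map_add, map_smul, hτv, hτv₀]) f]
      simp only [ev_smul, inv_inv]) 0
  rw [zero_smul, add_zero, map_sub, map_sum, map_sum, sub_eq_zero] at key
  simpa only [ev_smul, inv_inv] using key

/-- The twisted trace of `1` is constant along lines through the origin. -/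
lemma sum_ev_twist_one_eq {W : Subgroup (V ≃ₗ[ℂ] V)} {τ : V ≃ₗ[ℂ] V}
    (hτ : ∀ g ∈ W, τ⁻¹ * g * τ ∈ W) {n : ℕ} {h : Fin n → PolyFun V}
    {φ : Fin n → PolyFun V →+ PolyFun V} (hφ : IsDualSystem W h φ) {v : V}
    (hv : ∀ r ∈ invariants W, ev v (τ • r) = ev v r) :
    ∑ i, ev v (φ i (τ • h i)) = ∑ i, ev 0 (φ i (τ • h i)) := by
  have hscale (t : ℂ) (ht : t ≠ 0) :
      ∑ i, ev (t • v) (φ i (τ • h i)) = ∑ i, ev v (φ i (τ • h i)) := by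
    let c : V ≃ₗ[ℂ] V := LinearEquiv.smulOfNeZero ℂ V t⁻¹ (inv_ne_zero ht)
    have hc (x : V) : c x = t⁻¹ • x := rfl
    have hcinv (x : V) : c⁻¹ x = t • x := by
      apply c.injective
      rw [← LinearEquiv.mul_apply, mul_inv_cancel, hc, smul_smul, inv_mul_cancel₀ ht, one_smul]
      rfl
    have hcomm (g : V ≃ₗ[ℂ] V) : g * c = c * g := by
      ext x
      simp only [LinearEquiv.mul_apply, hc, map_smul]
    have hcomm' (g : V ≃ₗ[ℂ] V) : g * c⁻¹ = c⁻¹ * g := by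
      rw [mul_inv_eq_iff_eq_mul, mul_assoc, hcomm, inv_mul_cancel_left]
    have hcR {r : PolyFun V} (hr : r ∈ invariants W) : c • r ∈ invariants W :=
      mem_invariants.2 fun g hg => by
        rw [← mul_smul, hcomm, mul_smul, mem_invariants.1 hr g hg]
    have hcR' {r : PolyFun V} (hr : r ∈ invariants W) : c⁻¹ • r ∈ invariants W :=
      mem_invariants.2 fun g hg => by
        rw [← mul_smul, hcomm', mul_smul, mem_invariants.1 hr g hg]
    have hψ : IsDualSystem W (fun i => c • h i) (fun i =>
        ((DistribSMul.toAddMonoidHom (PolyFun V) c).comp (φ i)).comp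
          (DistribSMul.toAddMonoidHom (PolyFun V) c⁻¹)) := by
      refine ⟨fun i s => hcR (hφ.mem i _), fun i r hr s => ?_, fun s => ?_⟩
      · change c • φ i (c⁻¹ • (r * s)) = r * c • φ i (c⁻¹ • s)
        rw [smul_mul', hφ.map_mul _ _ (hcR' hr), smul_mul', smul_inv_smul]
      · change ∑ i, c • φ i (c⁻¹ • s) * c • h i = s
        simp only [← smul_mul']
        rw [← Finset.smul_sum, hφ.sum_eq, smul_inv_smul]
    have := sum_ev_dual_comm hτ hv hφ hψ (twist τ 1) (AddMonoidHom.id _)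
      (fun r _ s => by simp only [twist_apply, one_mul, smul_mul']) (fun r _ s => rfl)
    simp only [twist_apply, one_mul, AddMonoidHom.id_apply] at this
    rw [this]
    refine Finset.sum_congr rfl fun i _ => ?_
    change _ = ev v (c • φ i (c⁻¹ • τ • c • h i))
    rw [ev_smul, hcinv, ← mul_smul τ, hcomm, mul_smul, inv_smul_smul]
  have key := ev_line_eq_zero (∑ i, φ i (τ • h i) - C (∑ i, ev v (φ i (τ • h i)))) 0 v {0}
    (Set.finite_singleton 0) (fun t ht => by
      rw [zero_add, map_sub, ev_C, map_sum, hscale t ht, sub_self]) 0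
  rw [zero_smul, add_zero, map_sub, ev_C, map_sum, sub_eq_zero] at key
  exact key.symm

lemma one_mem_of_no_zero (I : Ideal (PolyFun V)) (h : ∀ u : V, ∃ p ∈ I, ev u p ≠ 0) :
    (1 : PolyFun V) ∈ I := by
  have hempty : zeroLocus ℂ I = ∅ := by
    rw [Set.eq_empty_iff_forall_notMem]
    intro x hx
    obtain ⟨p, hp, hpx⟩ := h ((finBasis ℂ V).equivFun.symm x)
    have hx' : (fun i => (finBasis ℂ V).repr ((finBasis ℂ V).equivFun.symm x) i) = x :=
      (finBasis ℂ V).equivFun.apply_symm_apply x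
    apply hpx
    change aeval _ p = 0
    rw [hx']
    exact hx p hp
  have h1 := vanishingIdeal_zeroLocus_eq_radical (K := ℂ) I
  rw [hempty] at h1
  have : (1 : PolyFun V) ∈ I.radical := by
    rw [← h1]
    simp [vanishingIdeal]
  obtain ⟨n, hn⟩ := this
  rwa [one_pow] at hn

lemma exists_invariant_separating (W : Subgroup (V ≃ₗ[ℂ] V)) [Finite W] {u v : V}
    (huv : ∀ w ∈ W, w v ≠ u) : ∃ r ∈ invariants W, ev v r = 0 ∧ ev u r ≠ 0 := by
  classical
  have := Fintype.ofFinite W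
  obtain ⟨f, hf, hf'⟩ := exists_ev_eq_one u
    ((Finset.univ.image fun w : W => (w : V ≃ₗ[ℂ] V) v) ∪
      (Finset.univ.image fun w : W => (w : V ≃ₗ[ℂ] V) u).erase u) (by
    simp only [Finset.mem_union, Finset.mem_image, Finset.mem_erase, ne_eq, not_true_eq_false,
      false_and, or_false, Finset.mem_univ, true_and, not_exists]
    exact fun w => huv w w.2)
  refine ⟨_, sum_smul_mem_invariants W f, ?_, ?_⟩
  · rw [map_sum]
    refine Finset.sum_eq_zero fun w _ => ?_
    rw [ev_smul]
    exact hf' _ (Finset.mem_union_left _ (Finset.mem_image_of_mem (fun w : W =>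
      (w : V ≃ₗ[ℂ] V) v) (Finset.mem_univ w⁻¹)))
  · have h (w : W) : ev u ((w : V ≃ₗ[ℂ] V) • f) =
        if (w : V ≃ₗ[ℂ] V)⁻¹ u = u then 1 else 0 := by
      rw [ev_smul]
      split_ifs with hw
      · rw [hw, hf]
      · exact hf' _ (Finset.mem_union_right _ (Finset.mem_erase.2 ⟨hw,
          Finset.mem_image_of_mem (fun w : W => (w : V ≃ₗ[ℂ] V) u) (Finset.mem_univ w⁻¹)⟩))
    rw [map_sum, Finset.sum_congr rfl fun w _ => h w, Finset.sum_boole, Nat.cast_ne_zero]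
    exact Finset.card_ne_zero_of_mem (a := (1 : W))
      (Finset.mem_filter.2 ⟨Finset.mem_univ _, rfl⟩)

/-- A `τ`-stable orbit on which the twisted trace of `1` does not vanish has a `τ`-fixed point. -/
lemma exists_fixed_of_trace_ne_zero {W : Subgroup (V ≃ₗ[ℂ] V)} [Finite W] {τ : V ≃ₗ[ℂ] V}
    (hτ : ∀ g ∈ W, τ⁻¹ * g * τ ∈ W) {n : ℕ} {h : Fin n → PolyFun V}
    {φ : Fin n → PolyFun V →+ PolyFun V} (hφ : IsDualSystem W h φ) {v : V}
    (hv : ∀ r ∈ invariants W, ev v (τ • r) = ev v r)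
    (hne : ∑ i, ev v (φ i (τ • h i)) ≠ 0) : ∃ w ∈ W, τ (w v) = w v := by
  by_contra! hno
  set I : Ideal (PolyFun V) := Ideal.span
    ({r | r ∈ invariants W ∧ ev v r = 0} ∪ Set.range fun g : PolyFun V => τ • g - g) with hI
  have hone : (1 : PolyFun V) ∈ I := by
    refine one_mem_of_no_zero I fun u => ?_
    by_cases hu : ∃ w ∈ W, w v = u
    · obtain ⟨w, hw, rfl⟩ := hu
      have hfix : (τ⁻¹ : V ≃ₗ[ℂ] V) (w v) ≠ w v := fun h => hno w hw (by
        conv_lhs => rw [← h]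
        exact τ.apply_symm_apply _)
      obtain ⟨g, hg, hg'⟩ := exists_ev_eq_one (w v) {(τ⁻¹ : V ≃ₗ[ℂ] V) (w v)}
        (by simpa using hfix.symm)
      refine ⟨τ • g - g, Ideal.subset_span (Or.inr ⟨g, rfl⟩), ?_⟩
      rw [map_sub, ev_smul, hg, hg' _ (Finset.mem_singleton_self _)]
      norm_num
    · push Not at hu
      obtain ⟨r, hr, hrv, hru⟩ := exists_invariant_separating W hu
      exact ⟨r, Ideal.subset_span (Or.inl ⟨hr, hrv⟩), hru⟩
  have hzero : ∀ a ∈ I, ∀ c : PolyFun V, ∑ i, ev v (φ i (τ • (c * a * h i))) = 0 := by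
    intro a ha
    rw [hI] at ha
    induction ha using Submodule.span_induction with
    | mem a ha =>
      intro c
      rcases ha with ⟨ha, hav⟩ | ⟨g, rfl⟩
      · refine Finset.sum_eq_zero fun i _ => ?_
        rw [mul_comm c a, mul_assoc, smul_mul', hφ.map_mul _ _ (smul_mem_invariants hτ ha),
          map_mul, hv a ha, hav, zero_mul]
      · have := sum_ev_dual_comm hτ hv hφ hφ (twist τ c) (AddMonoidHom.mulLeft (τ • g))
          (fun r _ s => by simp only [twist_apply, ← smul_mul']; congr 1; ring)
          (fun r _ s => by simp only [AddMonoidHom.coe_mulLeft]; ring)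
        simp only [twist_apply, AddMonoidHom.coe_mulLeft, ← smul_mul'] at this
        simp only [mul_sub, sub_mul, smul_sub, map_sub, Finset.sum_sub_distrib]
        rw [sub_eq_zero]
        simp only [mul_left_comm g c, ← mul_assoc] at this
        exact this.symm
    | zero => simp
    | add a b _ _ ha hb =>
      intro c
      simp only [mul_add, add_mul, smul_add, map_add, Finset.sum_add_distrib, ha, hb, add_zero]
    | smul b a _ ha =>
      intro c
      rw [smul_eq_mul, ← mul_assoc]
      exact ha (c * b)
  exact hne (by simpa using hzero 1 hone 1)

section Springer

variable {W : Subgroup (V ≃ₗ[ℂ] V)} [Finite W]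
  (hW : Subgroup.closure {g : V ≃ₗ[ℂ] V | g ∈ W ∧ IsReflection g} = W) {τ : V ≃ₗ[ℂ] V}
  (hτ : ∀ g ∈ W, τ⁻¹ * g * τ ∈ W) {v₀ : V} (hv₀ : v₀ ∈ VReg W) (hτv₀ : τ v₀ = v₀)

include hW hτ hv₀ hτv₀

/-- Every `τ`-stable orbit contains a `τ`-fixed point. -/
lemma exists_fixed_mem_orbit {v : V} (hv : ∃ x ∈ W, x v = τ v) : ∃ w ∈ W, τ (w v) = w v := by
  classical
  have := Fintype.ofFinite W
  obtain ⟨n, h, φ, hφ⟩ := exists_isDualSystem W hW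
  obtain ⟨x, hx, hxv⟩ := hv
  have hv : ∀ r ∈ invariants W, ev v (τ • r) = ev v r := fun r hr => by
    rw [← ev_invariant (smul_mem_invariants hτ hr) hx v, hxv, ev_smul]
    exact congrArg (fun y => ev y r) (τ.symm_apply_apply v)
  have hv₀' : ∀ r ∈ invariants W, ev v₀ (τ • r) = ev v₀ r := fun r hr => by
    conv_lhs => rw [← hτv₀, ev_smul]
    exact congrArg (fun y => ev y r) (τ.symm_apply_apply v₀)
  refine exists_fixed_of_trace_ne_zero hτ hφ hv ?_
  rw [sum_ev_twist_one_eq hτ hφ hv, ← sum_ev_twist_one_eq hτ hφ hv₀']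
  have := sum_ev_twist hτ hφ hv₀ hτv₀ hτv₀ 1
  simp only [one_mul] at this
  rw [this]
  simp only [map_one, Finset.sum_const, nsmul_eq_mul, mul_one, Nat.cast_ne_zero]
  exact Finset.card_ne_zero_of_mem (a := (1 : W)) (by simp)

/-- Two `τ`-fixed points in the same orbit are conjugate under the centralizer of `τ`. -/
lemma exists_commute_of_mem_orbit {u v : V} (hv : τ v = v) (hu : τ u = u)
    (huv : ∃ x ∈ W, x v = u) : ∃ w ∈ W, τ * w = w * τ ∧ w v = u := by
  classical
  have := Fintype.ofFinite W
  obtain ⟨n, h, φ, hφ⟩ := exists_isDualSystem W hW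
  by_contra! hno
  obtain ⟨f, hf, hf'⟩ := exists_ev_eq_one u
    ((Finset.univ.image fun w : W => (w : V ≃ₗ[ℂ] V) u).erase u ∪
      (Finset.univ.filter fun w : W => τ * w.1 = w.1 * τ).image fun w : W => (w : V ≃ₗ[ℂ] V) v) (by
    simp only [Finset.mem_union, Finset.mem_image, Finset.mem_erase, ne_eq, not_true_eq_false,
      false_and, false_or, Finset.mem_filter, Finset.mem_univ, true_and, not_exists, not_and]
    exact fun w hw => hno w w.2 hw)
  obtain ⟨x, hx, hxv⟩ := huv
  have heq : ∑ i, ev u (φ i (τ • (f * h i))) = ∑ i, ev v (φ i (τ • (f * h i))) :=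
    Finset.sum_congr rfl fun i _ => by rw [← hxv, ev_invariant (hφ.mem i _) hx]
  rw [sum_ev_twist hτ hφ hv₀ hτv₀ hu, sum_ev_twist hτ hφ hv₀ hτv₀ hv,
    Finset.sum_eq_zero (s := Finset.univ.filter fun w : W => τ * w.1 = w.1 * τ)
      (f := fun w : W => ev ((w : V ≃ₗ[ℂ] V) v) f) fun w hw =>
        hf' _ (Finset.mem_union_right _ (Finset.mem_image_of_mem (fun w : W =>
          (w : V ≃ₗ[ℂ] V) v) hw))] at heq
  have h (w : W) : ev ((w : V ≃ₗ[ℂ] V) u) f = if (w : V ≃ₗ[ℂ] V) u = u then 1 else 0 := by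
    split_ifs with hw
    · rw [hw, hf]
    · exact hf' _ (Finset.mem_union_left _ (Finset.mem_erase.2 ⟨hw,
        Finset.mem_image_of_mem (fun w : W => (w : V ≃ₗ[ℂ] V) u) (Finset.mem_univ w)⟩))
  rw [Finset.sum_congr rfl fun w _ => h w, Finset.sum_boole, Nat.cast_eq_zero] at heq
  exact Finset.card_ne_zero_of_mem (a := (1 : W)) (by simp) heq

end Springer

end PolyFun

/-- (Springer) If `τ` is a regular element normalizing the complex reflection group `W`,
then sending the `W^τ`-orbit of a point `v ∈ V^τ` to its `W`-orbit is a bijection from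
the set of `W^τ`-orbits on `V^τ` onto the set of `τ`-stable `W`-orbits on `V`. -/
theorem stmt1 (W : Subgroup (V ≃ₗ[ℂ] V)) [Finite W]
    (hW : Subgroup.closure {g : V ≃ₗ[ℂ] V | g ∈ W ∧ IsReflection g} = W)
    (τ : V ≃ₗ[ℂ] V) (hτfin : IsOfFinOrder τ)
    (hnorm : ∀ g : V ≃ₗ[ℂ] V, g ∈ W ↔ τ * g * τ⁻¹ ∈ W)
    (hreg : ∃ v ∈ VReg W, τ v = v) :
    ∃ f : {S : Set V // ∃ v : V, τ v = v ∧ S = {u | ∃ w ∈ W, τ * w = w * τ ∧ w v = u}} →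
          {S : Set V // (∃ v : V, S = {u | ∃ w ∈ W, w v = u}) ∧ (fun x => τ x) '' S = S},
      Function.Bijective f ∧
      ∀ (v : V) (hv : τ v = v),
        (f ⟨{u | ∃ w ∈ W, τ * w = w * τ ∧ w v = u}, v, hv, rfl⟩ : Set V) =
          {u | ∃ w ∈ W, w v = u} := by
  obtain ⟨v₀, hv₀, hτv₀⟩ := hreg
  have hτ : ∀ g ∈ W, τ⁻¹ * g * τ ∈ W := fun g hg => (hnorm _).2 (by
    have : τ * (τ⁻¹ * g * τ) * τ⁻¹ = g := by group
    rwa [this])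
  have orbit_eq {x : V ≃ₗ[ℂ] V} (hx : x ∈ W) (v : V) :
      {u | ∃ w ∈ W, w (x v) = u} = {u | ∃ w ∈ W, w v = u} := by
    ext u
    constructor
    · rintro ⟨w, hw, rfl⟩
      exact ⟨w * x, W.mul_mem hw hx, rfl⟩
    · rintro ⟨w, hw, rfl⟩
      refine ⟨w * x⁻¹, W.mul_mem hw (W.inv_mem hx), ?_⟩
      rw [← LinearEquiv.mul_apply, inv_mul_cancel_right]
  have saturate (v : V) : {u | ∃ w ∈ W, ∃ y ∈ {u | ∃ w ∈ W, τ * w = w * τ ∧ w v = u}, w y = u} =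
      {u | ∃ w ∈ W, w v = u} := by
    ext u
    constructor
    · rintro ⟨w, hw, y, ⟨x, hx, -, rfl⟩, rfl⟩
      exact ⟨w * x, W.mul_mem hw hx, rfl⟩
    · rintro ⟨w, hw, rfl⟩
      exact ⟨w, hw, v, ⟨1, W.one_mem, by rw [mul_one, one_mul], rfl⟩, rfl⟩
  have stable {v : V} (hv : τ v = v) :
      (fun x => τ x) '' {u | ∃ w ∈ W, w v = u} = {u | ∃ w ∈ W, w v = u} := by
    have hinv : (τ⁻¹ : V ≃ₗ[ℂ] V) v = v := by
      conv_lhs => rw [← hv]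
      exact τ.symm_apply_apply v
    ext u
    constructor
    · rintro ⟨_, ⟨w, hw, rfl⟩, rfl⟩
      refine ⟨τ * w * τ⁻¹, (hnorm w).1 hw, ?_⟩
      simp only [LinearEquiv.mul_apply, hinv]
    · rintro ⟨w, hw, rfl⟩
      refine ⟨_, ⟨τ⁻¹ * w * τ, hτ w hw, rfl⟩, ?_⟩
      change (τ * (τ⁻¹ * w * τ)) v = w v
      rw [mul_assoc, mul_inv_cancel_left, LinearEquiv.mul_apply, hv]
  refine ⟨fun S => ⟨{u | ∃ w ∈ W, ∃ y ∈ (S : Set V), w y = u}, ?_, ?_⟩, ⟨?_, ?_⟩, ?_⟩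
  · obtain ⟨S, v, hv, rfl⟩ := S
    exact ⟨v, saturate v⟩
  · obtain ⟨S, v, hv, rfl⟩ := S
    rw [saturate v]
    exact stable hv
  · rintro ⟨S, v, hv, rfl⟩ ⟨S', v', hv', rfl⟩ h
    have h1 := congrArg Subtype.val h
    simp only [saturate] at h1
    have h2 : v' ∈ {u | ∃ w ∈ W, w v = u} := by
      rw [h1]
      exact ⟨1, W.one_mem, rfl⟩
    obtain ⟨x, hx, hxτ, rfl⟩ :=
      PolyFun.exists_commute_of_mem_orbit hW hτ hv₀ hτv₀ hv hv' h2
    apply Subtype.ext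
    ext u
    constructor
    · rintro ⟨w, hw, hwτ, rfl⟩
      refine ⟨w * x⁻¹, W.mul_mem hw (W.inv_mem hx), ?_, ?_⟩
      · exact Commute.mul_right (show Commute τ w from hwτ) (Commute.inv_right hxτ)
      · rw [← LinearEquiv.mul_apply, inv_mul_cancel_right]
    · rintro ⟨w, hw, hwτ, rfl⟩
      exact ⟨w * x, W.mul_mem hw hx,
        Commute.mul_right (show Commute τ w from hwτ) hxτ, rfl⟩
  · rintro ⟨_, ⟨v, rfl⟩, hS⟩
    have hv : τ v ∈ {u | ∃ w ∈ W, w v = u} := by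
      rw [← hS]
      exact ⟨v, ⟨1, W.one_mem, rfl⟩, rfl⟩
    obtain ⟨x, hx, hxv⟩ := PolyFun.exists_fixed_mem_orbit hW hτ hv₀ hτv₀ hv
    refine ⟨⟨_, x v, hxv, rfl⟩, Subtype.ext ?_⟩
    simp only [saturate, orbit_eq hx]
  · intro v hv
    exact saturate v
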